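/- Let N be a finite set and let B ⊆ A_N consist of two distinct CI statements such that B is not a gaussoid. Then every minimal gaussoid extension of B has exactly four elements, and for every minimal gaussoid extension G of B and every rational ε > 0 there exists a symmetric positive-definite matrix Σ with rational entries, indexed by N, such that CIS(Σ) = G and |Σ_{ab} − I_{ab}| < ε for all a, b ∈ N, where I is the identity matrix. -/

import Mathlib

open scoped symmDiff

abbrev CIStmt (N : Type*) := Sym2 N × Finset N

def CIStmt.proper {N : Type*} (s : CIStmt N) : Prop :=
  ¬ s.1.IsDiag ∧ ∀ i ∈ s.1, i ∉ s.2

variable {N : Type*} [DecidableEq N]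

def pminor {R : Type*} [CommRing R] (M : Matrix N N R) (S : Finset N) : R :=
  (M.submatrix (fun a : S => (a : N)) (fun a : S => (a : N))).det

def apminor {R : Type*} [CommRing R] (M : Matrix N N R) (i j : N) (K : Finset N) : R :=
  (Matrix.of fun a b : Unit ⊕ ↥K =>
      M (Sum.elim (fun _ => i) (fun k => (k : N)) a)
        (Sum.elim (fun _ => j) (fun k => (k : N)) b)).det

def PrinReg {R : Type*} [CommRing R] (M : Matrix N N R) : Prop :=
  ∀ S : Finset N, pminor M S ≠ 0

def PosDefMinors {R : Type*} [Field R] [LinearOrder R] [IsStrictOrderedRing R] (M : Matrix N N R) : Prop :=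
  ∀ S : Finset N, 0 < pminor M S

def CIS {R : Type*} [CommRing R] (M : Matrix N N R) : Set (CIStmt N) :=
  {s | s.proper ∧ ∀ i j : N, s.1 = s(i, j) → apminor M i j s.2 = 0}

def IsGaussoid (G : Set (CIStmt N)) : Prop :=
  (∀ s ∈ G, s.proper) ∧
  ∀ i j k : N, ∀ L : Finset N,
    i ≠ j → i ≠ k → j ≠ k → i ∉ L → j ∉ L → k ∉ L →
      (((s(i,j), L) ∈ G ∧ (s(i,k), insert j L) ∈ G) ↔
        ((s(i,k), L) ∈ G ∧ (s(i,j), insert k L) ∈ G)) ∧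
      (((s(i,j), insert k L) ∈ G ∧ (s(i,k), insert j L) ∈ G) ↔
        ((s(i,j), L) ∈ G ∧ (s(i,k), L) ∈ G)) ∧
      (((s(i,j), L) ∈ G ∧ (s(i,j), insert k L) ∈ G) →
        ((s(i,k), L) ∈ G ∨ (s(j,k), L) ∈ G))



def FF (i j k : N) (L : Finset N) : Set (CIStmt N) :=
  {(s(i,j), L), (s(i,k), L), (s(i,j), insert k L), (s(i,k), insert j L)}

lemma mem_FF (i j k a b : N) (L K : Finset N) : (s(a,b), K) ∈ FF i j k L ↔
    ((a = i ∧ b = j ∨ a = j ∧ b = i) ∧ (K = L ∨ K = insert k L)) ∨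
    ((a = i ∧ b = k ∨ a = k ∧ b = i) ∧ (K = L ∨ K = insert j L)) := by
  simp only [FF, Set.mem_insert_iff, Set.mem_singleton_iff, Prod.mk.injEq, Sym2.eq_iff]
  tauto

lemma FF_gaussoid {i j k : N} {L : Finset N} (hij : i ≠ j) (hik : i ≠ k) (hjk : j ≠ k)
    (hi : i ∉ L) (hj : j ∉ L) (hk : k ∉ L) : IsGaussoid (FF i j k L) := by
  constructor
  · rintro s hs
    simp only [FF, Set.mem_insert_iff, Set.mem_singleton_iff] at hs
    rcases hs with rfl | rfl | rfl | rfl <;>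
      simp only [CIStmt.proper, Sym2.mk_isDiag_iff, Sym2.mem_iff] <;> grind
  · intro a b c K hab hac hbc ha hb hc
    simp only [mem_FF]
    have k2 : ∀ x y : N, x ∉ K → y ∉ K → y ∉ L → x ≠ y → insert x K ≠ insert y L := by
      intro x y hx hy hy2p hne h
      have : y ∈ insert x K := by rw [h]; simp
      grind
    have k3 : ∀ x : N, x ∉ K → x ∉ L → insert x K = insert x L → K = L := by
      intro x hx hy h
      rw [← Finset.erase_insert hx, h, Finset.erase_insert hy]
    have k4 : ∀ x : N, x ∉ K → x ∉ L → insert x K ≠ L := by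
      grind
    have k5 : ∀ x : N, x ∉ K → K ≠ insert x L := by
      grind
    refine ⟨⟨?_, ?_⟩, ⟨?_, ?_⟩, ?_⟩
    · rintro ⟨h1, h2⟩
      rcases h1 with ⟨⟨rfl, rfl⟩ | ⟨rfl, rfl⟩, h1 | h1⟩ | ⟨⟨rfl, rfl⟩ | ⟨rfl, rfl⟩, h1 | h1⟩ <;> grind
    · rintro ⟨h1, h2⟩
      rcases h1 with ⟨⟨rfl, rfl⟩ | ⟨rfl, rfl⟩, h1 | h1⟩ | ⟨⟨rfl, rfl⟩ | ⟨rfl, rfl⟩, h1 | h1⟩ <;> grind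
    · rintro ⟨h1, h2⟩
      rcases h1 with ⟨⟨rfl, rfl⟩ | ⟨rfl, rfl⟩, h1 | h1⟩ | ⟨⟨rfl, rfl⟩ | ⟨rfl, rfl⟩, h1 | h1⟩ <;> grind
    · rintro ⟨h1, h2⟩
      rcases h1 with ⟨⟨rfl, rfl⟩ | ⟨rfl, rfl⟩, h1 | h1⟩ | ⟨⟨rfl, rfl⟩ | ⟨rfl, rfl⟩, h1 | h1⟩ <;> grind
    · rintro ⟨h1, h2⟩
      rcases h1 with ⟨⟨rfl, rfl⟩ | ⟨rfl, rfl⟩, h1 | h1⟩ | ⟨⟨rfl, rfl⟩ | ⟨rfl, rfl⟩, h1 | h1⟩ <;> grind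

lemma FF_encard {i j k : N} {L : Finset N} (hij : i ≠ j) (hik : i ≠ k) (hjk : j ≠ k)
    (hj : j ∉ L) (hk : k ∉ L) : (FF i j k L).encard = 4 := by
  have h1 : L ≠ insert k L := by grind
  have h2 : L ≠ insert j L := by grind
  have : FF i j k L = (({(s(i,j), L), (s(i,k), L), (s(i,j), insert k L), (s(i,k), insert j L)} : Finset (CIStmt N)) : Set (CIStmt N)) := by
    simp [FF]
  rw [this, Set.encard_coe_eq_coe_finsetCard]
  rw [Finset.card_insert_of_notMem, Finset.card_insert_of_notMem, Finset.card_insert_of_notMem]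
  · simp
  all_goals simp only [Finset.mem_insert, Finset.mem_singleton, Prod.mk.injEq, Sym2.eq_iff]
  all_goals grind

lemma FF_sub {G : Set (CIStmt N)} (hG : IsGaussoid G) {s t : CIStmt N}
    (hs : s.proper) (ht : t.proper)
    (hnotg : ¬ IsGaussoid ({s, t} : Set (CIStmt N))) (hsub : ({s, t} : Set (CIStmt N)) ⊆ G) :
    ∃ i j k : N, ∃ L : Finset N, i ≠ j ∧ i ≠ k ∧ j ≠ k ∧ i ∉ L ∧ j ∉ L ∧ k ∉ L ∧
      FF i j k L ⊆ G ∧ ({s, t} : Set (CIStmt N)) ⊆ FF i j k L := by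
  by_contra hcon
  apply hnotg
  refine ⟨by grind, ?_⟩
  intro i j k L hij hik hjk hi hj hk
  obtain ⟨-, hG⟩ := hG
  have g1 := hG i j k L hij hik hjk hi hj hk
  have g2 := hG j i k L hij.symm hjk hik hj hi hk
  have e1 : ∀ x : N, L ≠ insert x L ∨ x ∈ L := by grind
  have hkL : L ≠ insert k L := by grind
  have hjL : L ≠ insert j L := by grind
  have key : ∀ i j k : N, i ≠ j → i ≠ k → j ≠ k → i ∉ L → j ∉ L → k ∉ L → 
      (s(i,j), L) ∈ G → (s(i,k), L) ∈ G → (s(i,j), insert k L) ∈ G → (s(i,k), insert j L) ∈ G →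
      ∀ u v : CIStmt N, u ∈ ({s,t} : Set (CIStmt N)) → v ∈ ({s,t} : Set (CIStmt N)) → u ≠ v →
      u ∈ FF i j k L → v ∈ FF i j k L → False := by
    intro i j k a1 a2 a3 a4 a5 a6 m1 m2 m3 m4 u v hu hv huv hu2p hv2p
    apply hcon
    refine ⟨i, j, k, L, a1, a2, a3, a4, a5, a6, ?_, ?_⟩
    · intro z hz
      simp only [FF, Set.mem_insert_iff, Set.mem_singleton_iff] at hz
      grind
    · intro z hz
      simp only [Set.mem_insert_iff, Set.mem_singleton_iff] at hz hu hv
      grind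
  have n1 : s(i,j) ≠ s(i,k) := by simp only [ne_eq, Sym2.eq_iff]; grind
  have f1 := hij.symm
  have key1 := key i j k hij hik hjk hi hj hk
  have key2 := key j i k hij.symm hjk hik hj hi hk
  have sw : s(j,i) = s(i,j) := Sym2.eq_swap
  rw [sw] at g2 key2
  refine ⟨⟨?_, ?_⟩, ⟨?_, ?_⟩, ?_⟩
  · rintro ⟨h1, h2⟩
    have m1 := hsub h1
    have m2 := hsub h2
    have q : (s(i,j), L) ∈ G ∧ (s(i,k), L) ∈ G ∧ (s(i,j), insert k L) ∈ G ∧ (s(i,k), insert j L) ∈ G :=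
      ⟨m1, (g1.1.1 ⟨m1, m2⟩).1, (g1.1.1 ⟨m1, m2⟩).2, m2⟩
    exact (key1 q.1 q.2.1 q.2.2.1 q.2.2.2 _ _ h1 h2 (by simp [n1]) (by simp [FF]) (by simp [FF])).elim
  · rintro ⟨h1, h2⟩
    have m1 := hsub h1
    have m2 := hsub h2
    have q : (s(i,j), L) ∈ G ∧ (s(i,k), L) ∈ G ∧ (s(i,j), insert k L) ∈ G ∧ (s(i,k), insert j L) ∈ G :=
      ⟨(g1.1.2 ⟨m1, m2⟩).1, m1, m2, (g1.1.2 ⟨m1, m2⟩).2⟩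
    exact (key1 q.1 q.2.1 q.2.2.1 q.2.2.2 _ _ h1 h2 (by simp [n1.symm]) (by simp [FF]) (by simp [FF])).elim
  · rintro ⟨h1, h2⟩
    have m1 := hsub h1
    have m2 := hsub h2
    have q : (s(i,j), L) ∈ G ∧ (s(i,k), L) ∈ G ∧ (s(i,j), insert k L) ∈ G ∧ (s(i,k), insert j L) ∈ G :=
      ⟨(g1.2.1.1 ⟨m1, m2⟩).1, (g1.2.1.1 ⟨m1, m2⟩).2, m1, m2⟩
    exact (key1 q.1 q.2.1 q.2.2.1 q.2.2.2 _ _ h1 h2 (by simp [n1]) (by simp [FF]) (by simp [FF])).elim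
  · rintro ⟨h1, h2⟩
    have m1 := hsub h1
    have m2 := hsub h2
    have q : (s(i,j), L) ∈ G ∧ (s(i,k), L) ∈ G ∧ (s(i,j), insert k L) ∈ G ∧ (s(i,k), insert j L) ∈ G :=
      ⟨m1, m2, (g1.2.1.2 ⟨m1, m2⟩).1, (g1.2.1.2 ⟨m1, m2⟩).2⟩
    exact (key1 q.1 q.2.1 q.2.2.1 q.2.2.2 _ _ h1 h2 (by simp [n1]) (by simp [FF]) (by simp [FF])).elim
  · rintro ⟨h1, h2⟩
    have m1 := hsub h1
    have m2 := hsub h2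
    have h3 := g1.2.2 ⟨hsub h1, hsub h2⟩
    rcases h3 with h3 | h3
    · have q : (s(i,j), L) ∈ G ∧ (s(i,k), L) ∈ G ∧ (s(i,j), insert k L) ∈ G ∧ (s(i,k), insert j L) ∈ G :=
      ⟨m1, h3, m2, (g1.1.2 ⟨h3, m2⟩).2⟩
      exact (key1 q.1 q.2.1 q.2.2.1 q.2.2.2 _ _ h1 h2 (by simpa using hkL) (by simp [FF]) (by simp [FF])).elim
    · have q : (s(i,j), L) ∈ G ∧ (s(j,k), L) ∈ G ∧ (s(i,j), insert k L) ∈ G ∧ (s(j,k), insert i L) ∈ G :=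
      ⟨m1, h3, m2, (g2.1.2 ⟨h3, m2⟩).2⟩
      exact (key2 q.1 q.2.1 q.2.2.1 q.2.2.2 _ _ h1 h2 (by simpa using hkL) (by simp [FF, sw]) (by simp [FF, sw])).elim

lemma apminor_map {R S : Type*} [CommRing R] [CommRing S] (f : R →+* S) (M : Matrix N N R)
    (i j : N) (K : Finset N) : apminor (M.map f) i j K = f (apminor M i j K) := by
  unfold apminor
  rw [RingHom.map_det]
  rfl

lemma apminor_symm {R : Type*} [CommRing R] (M : Matrix N N R) (hM : M.IsSymm)
    (i j : N) (K : Finset N) : apminor M i j K = apminor M j i K := by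
  unfold apminor
  rw [← Matrix.det_transpose]
  congr 1
  ext a b
  exact hM.apply _ _

lemma apminor_one {R : Type*} [CommRing R] (M : Matrix N N R)
    (i j : N) (K : Finset N) (h : ∀ a ∈ K, ∀ b ∈ K, M a b = if a = b then 1 else 0) :
    apminor M i j K = M i j - ∑ k ∈ K, M i k * M k j := by
  have : (Matrix.of fun a b : Unit ⊕ ↥K =>
      M (Sum.elim (fun _ => i) (fun k => (k : N)) a)
        (Sum.elim (fun _ => j) (fun k => (k : N)) b)) =
      Matrix.fromBlocks (Matrix.of fun _ _ : Unit => M i j) (Matrix.of fun (_ : Unit) (b : K) => M i b)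
       (Matrix.of fun (a : K) (_ : Unit) => M a j) 1 := by
    ext a b
    rcases a with a | a <;> rcases b with b | b
    · rfl
    · rfl
    · rfl
    · change M a b = (1 : Matrix K K R) a b
      rw [h a a.2 b b.2, Matrix.one_apply]
      simp only [Subtype.coe_inj]
  unfold apminor
  rw [this, Matrix.det_fromBlocks_one₂₂]
  rw [Matrix.det_unique]
  simp only [Matrix.sub_apply, Matrix.mul_apply, Matrix.of_apply]
  rw [Finset.sum_coe_sort K (fun k => M i k * M k j)]

/-- off-diagonal symmetric matrix with unit diagonal -/
def bas {R : Type*} [CommRing R] (x : Sym2 N → R) (a b : N) : R :=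
  if a = b then 1 else x s(a,b)

/-- generic matrix for i independent of jk given L -/
def genM {R : Type*} [CommRing R] (i j k : N) (L : Finset N) (x : Sym2 N → R) : Matrix N N R :=
  Matrix.of fun a b =>
    if a = i ∧ (b ∈ L ∨ b = j ∨ b = k) then ∑ l ∈ L, x s(i,l) * bas x l b
    else if b = i ∧ (a ∈ L ∨ a = j ∨ a = k) then ∑ l ∈ L, x s(i,l) * bas x l a
    else bas x a b

lemma bas_symm {R : Type*} [CommRing R] (x : Sym2 N → R) (a b : N) : bas x a b = bas x b a := by
  unfold bas
  rw [Sym2.eq_swap]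
  simp only [eq_comm]

lemma genM_symm {R : Type*} [CommRing R] {i j k : N} {L : Finset N}
    (hij : i ≠ j) (hik : i ≠ k) (hi : i ∉ L) (x : Sym2 N → R) :
    (genM i j k L x).IsSymm := by
  apply Matrix.IsSymm.ext
  intro a b
  simp only [genM, Matrix.of_apply]
  rw [bas_symm x b a]
  split_ifs <;> grind

lemma genM_map {R S : Type*} [CommRing R] [CommRing S] (f : R →+* S) (i j k : N) (L : Finset N)
    (x : Sym2 N → R) : (genM i j k L x).map f = genM i j k L (f ∘ x) := by
  ext a b
  simp only [genM, Matrix.of_apply, Matrix.map_apply, bas]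
  split_ifs <;> simp [apply_ite f]

lemma genM_vanish {R : Type*} [CommRing R] {i j k : N} {L : Finset N}
    (hij : i ≠ j) (hik : i ≠ k) (hi : i ∉ L) (x : Sym2 N → R) (b : N) (K : Finset N)
    (hb : b = j ∨ b = k) (hLK : L ⊆ K) (hK : ∀ m ∈ K, m ∈ L ∨ m = j ∨ m = k) :
    apminor (genM i j k L x) i b K = 0 := by
  unfold apminor
  set A := (Matrix.of fun a c : Unit ⊕ ↥K =>
      (genM i j k L x) (Sum.elim (fun _ => i) (fun k => (k : N)) a)
        (Sum.elim (fun _ => b) (fun k => (k : N)) c)) with hA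
  have hlast : ∃ v : Unit ⊕ ↥K → R, v (Sum.inl ()) = 1 ∧ Matrix.vecMul v A = 0 := by
    refine ⟨Sum.elim (fun _ => 1) (fun m => if (m : N) ∈ L then - x s(i, m) else 0), rfl, ?_⟩
    ext c
    have hc : ∀ c : N, (c ∈ L ∨ c = j ∨ c = k) → genM i j k L x i c +
        ∑ m : K, (if (m : N) ∈ L then - x s(i, m) else 0) * genM i j k L x m c = 0 := by
      intro c hc
      rw [Finset.sum_coe_sort K (fun m => (if (m : N) ∈ L then - x s(i, m) else 0) * genM i j k L x m c)]
      simp only [ite_mul, zero_mul]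
      rw [← Finset.sum_filter, Finset.filter_mem_eq_inter, Finset.inter_eq_right.mpr hLK]
      rw [show genM i j k L x i c = ∑ l ∈ L, x s(i,l) * bas x l c by simp [genM, hc]]
      rw [← Finset.sum_add_distrib]
      apply Finset.sum_eq_zero
      intro l hl
      have h1 : l ≠ i := by grind
      have h2 : c ≠ i := by grind
      simp [genM, h1, h2]
    have := hc (Sum.elim (fun _ => b) (fun k => (k : N)) c) (by
      rcases c with c | c
      · exact Or.inr hb
      · exact hK c c.2)
    simp only [Matrix.vecMul, dotProduct, Fintype.sum_sum_type, Pi.zero_apply, Sum.elim_inl,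
      Sum.elim_inr, one_mul, Fintype.sum_unique]
    exact this
  obtain ⟨v, hv1, hv⟩ := hlast
  have h3 : Matrix.vecMul (Matrix.vecMul v A) A.adjugate = 0 := by rw [hv]; simp
  rw [Matrix.vecMul_vecMul, Matrix.mul_adjugate] at h3
  have := congrFun h3 (Sum.inl ())
  simpa [Matrix.vecMul_smul, hv1] using this

/-- witness point -/
def wit (E : Finset (Sym2 N)) : Sym2 N → ℚ := fun e => if e ∈ E then 1 else 0

lemma genM_swap {R : Type*} [CommRing R] (i j k : N) (L : Finset N) (x : Sym2 N → R) :
    genM i j k L x = genM i k j L x := by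
  ext a b
  simp only [genM, Matrix.of_apply]
  congr 1
  · grind
  · congr 1
    grind

lemma wit_ij {i j k : N} {L : Finset N} (hij : i ≠ j) (hik : i ≠ k) (hjk : j ≠ k)
    (hi : i ∉ L) (hj : j ∉ L) (hk : k ∉ L) (K : Finset N)
    (hiK : i ∉ K) (hjK : j ∉ K) (h1 : K ≠ L) (h2 : K ≠ insert k L) :
    ∃ x : Sym2 N → ℚ, apminor (genM i j k L x) i j K ≠ 0 := by
  by_cases hLK : L ⊆ K
  · obtain ⟨m, hmK, hmL, hmk⟩ : ∃ m ∈ K, m ∉ L ∧ m ≠ k := by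
      by_contra hcon
      push Not at hcon
      by_cases hkK : k ∈ K
      · apply h2; grind
      · apply h1; grind
    have hmi : m ≠ i := by grind
    have hmj : m ≠ j := by grind
    set x := wit {s(i,m), s(m,j)} with hx
    have hc : ∀ l ∈ L, x s(i,l) = 0 := by
      intro l hl
      simp only [hx, wit, Finset.mem_insert, Finset.mem_singleton, Sym2.eq_iff]
      grind
    have hM : ∀ c d, genM i j k L x c d = if c = d then 1 else
        if s(c,d) = s(i,m) ∨ s(c,d) = s(m,j) then 1 else 0 := by
      intro c d
      have hs : ∀ d, ∑ l ∈ L, x s(i,l) * bas x l d = 0 := fun d =>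
        Finset.sum_eq_zero fun l hl => by rw [hc l hl, zero_mul]
      simp only [genM, Matrix.of_apply, hs]
      simp only [bas]
      simp only [hx, wit, Finset.mem_insert, Finset.mem_singleton, Sym2.eq_iff]
      grind
    refine ⟨x, ?_⟩
    rw [apminor_one, Finset.sum_eq_single m]
    · simp only [hM, Sym2.eq_iff]
      grind
    · intro c hc hcm
      simp only [hM, Sym2.eq_iff]
      grind
    · exact fun h => absurd hmK h
    · intro c hc d hd
      simp only [hM, Sym2.eq_iff]
      grind
  · obtain ⟨m, hmL, hmK⟩ := Finset.not_subset.mp hLK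
    have hmi : m ≠ i := by grind
    have hmj : m ≠ j := by grind
    have hmk : m ≠ k := by grind
    set x := wit {s(i,m), s(m,j)} with hx
    have hM : ∀ c d, genM i j k L x c d = if c = d then 1 else
        if s(c,d) = s(i,m) ∨ s(c,d) = s(m,j) ∨ s(c,d) = s(i,j) then 1 else 0 := by
      intro c d
      have hs : ∀ d, ∑ l ∈ L, x s(i,l) * bas x l d = bas x m d := by
        intro d
        rw [Finset.sum_eq_single m]
        · simp [hx, wit]
        · intro l hl hne
          have : x s(i,l) = 0 := by
            simp only [hx, wit, Finset.mem_insert, Finset.mem_singleton, Sym2.eq_iff]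
            grind
          rw [this, zero_mul]
        · exact fun h => absurd hmL h
      simp only [genM, Matrix.of_apply, hs]
      simp only [bas]
      simp only [hx, wit, Finset.mem_insert, Finset.mem_singleton, Sym2.eq_iff]
      grind
    refine ⟨x, ?_⟩
    rw [apminor_one, Finset.sum_eq_zero]
    · simp [hM, hij]
    · intro c hc
      simp only [hM, Sym2.eq_iff]
      grind
    · intro c hc d hd
      simp only [hM, Sym2.eq_iff]
      grind

lemma wit_exists {i j k : N} {L : Finset N} (hij : i ≠ j) (hik : i ≠ k) (hjk : j ≠ k)
    (hi : i ∉ L) (hj : j ∉ L) (hk : k ∉ L) (a b : N) (K : Finset N) (hab : a ≠ b)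
    (ha : a ∉ K) (hb : b ∉ K) (hn : (s(a,b), K) ∉ FF i j k L) :
    ∃ x : Sym2 N → ℚ, apminor (genM i j k L x) a b K ≠ 0 := by
  have hsymm : ∀ x : Sym2 N → ℚ, ∀ a b, apminor (genM i j k L x) a b K =
      apminor (genM i j k L x) b a K := fun x a b => apminor_symm _ (genM_symm hij hik hi x) a b K
  by_cases h1 : s(a,b) = s(i,j)
  · have hn2p : K ≠ L ∧ K ≠ insert k L := by
      rw [h1, mem_FF] at hn
      grind
    have := wit_ij hij hik hjk hi hj hk K (by grind [Sym2.eq_iff]) (by grind [Sym2.eq_iff]) hn2p.1 hn2p.2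
    obtain ⟨x, hx⟩ := this
    refine ⟨x, ?_⟩
    rw [Sym2.eq_iff] at h1
    rcases h1 with ⟨rfl, rfl⟩ | ⟨rfl, rfl⟩
    · exact hx
    · rw [hsymm]; exact hx
  by_cases h2 : s(a,b) = s(i,k)
  · have hn2p : K ≠ L ∧ K ≠ insert j L := by
      rw [h2, mem_FF] at hn
      grind
    have := wit_ij hik hij hjk.symm hi hk hj K (by grind [Sym2.eq_iff]) (by grind [Sym2.eq_iff]) hn2p.1 hn2p.2
    obtain ⟨x, hx⟩ := this
    refine ⟨x, ?_⟩
    rw [genM_swap] at hx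
    rw [Sym2.eq_iff] at h2
    rcases h2 with ⟨rfl, rfl⟩ | ⟨rfl, rfl⟩
    · exact hx
    · rw [hsymm]; exact hx
  refine ⟨wit {s(a,b)}, ?_⟩
  have hM : genM i j k L (wit {s(a,b)}) = Matrix.of fun c d =>
      if c = d then 1 else if s(c,d) = s(a,b) then 1 else 0 := by
    ext c d
    simp only [genM, Matrix.of_apply]
    have hb : ∀ c d, bas (wit {s(a,b)}) c d = if c = d then 1 else if s(c,d) = s(a,b) then 1 else 0 := by
      intro c d; simp [bas, wit]
    have hsum : ∀ d, (d ∈ L ∨ d = j ∨ d = k) → ∑ l ∈ L, wit {s(a,b)} s(i,l) * bas (wit {s(a,b)}) l d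
        = if s(i,d) = s(a,b) then 1 else 0 := by
      intro d hd
      by_cases hl : ∃ l ∈ L, s(i,l) = s(a,b)
      · obtain ⟨l, hl, he⟩ := hl
        rw [Finset.sum_eq_single l]
        · rw [hb]
          have hw : wit {s(a,b)} s(i,l) = 1 := by simp [wit, he]
          rw [hw, one_mul]
          rw [Sym2.eq_iff] at he
          simp only [Sym2.eq_iff]
          grind
        · intro m hm hne
          simp only [wit, Finset.mem_singleton, Sym2.eq_iff] at *
          grind
        · exact fun h => absurd hl h
      · rw [Finset.sum_eq_zero]
        · simp only [Sym2.eq_iff] at *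
          grind
        · intro l hl2p
          simp only [wit, Finset.mem_singleton]
          grind
    rw [hb]
    by_cases g1 : c = i ∧ (d ∈ L ∨ d = j ∨ d = k)
    · rw [if_pos g1, hsum _ g1.2, if_neg (show c ≠ d by grind), g1.1]
    · rw [if_neg g1]
      by_cases g2 : d = i ∧ (c ∈ L ∨ c = j ∨ c = k)
      · rw [if_pos g2, hsum _ g2.2, if_neg (show c ≠ d by grind), g2.1, Sym2.eq_swap]
      · rw [if_neg g2]
  rw [apminor_one, Finset.sum_eq_zero]
  · simp [hM]
  · intro m hm
    simp only [hM, Matrix.of_apply, Sym2.eq_iff]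
    grind
  · intro c hc d hd
    simp only [hM, Matrix.of_apply, Sym2.eq_iff]
    grind

lemma genM_zero {R : Type*} [CommRing R] (i j k : N) (L : Finset N)
    (hij : i ≠ j) (hik : i ≠ k) (hi : i ∉ L) :
    genM i j k L (0 : Sym2 N → R) = 1 := by
  ext a b
  simp only [genM, Matrix.of_apply, bas, Matrix.one_apply]
  simp
  grind

lemma genM_cont (i j k : N) (L : Finset N) : Continuous (fun x : Sym2 N → ℚ => genM i j k L x) := by
  refine continuous_matrix fun a b => ?_
  have hb : ∀ a b : N, Continuous (fun x : Sym2 N → ℚ => bas x a b) := by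
    intro a b
    unfold bas
    split_ifs <;> fun_prop
  simp only [genM, Matrix.of_apply]
  split_ifs <;> fun_prop

lemma realize {N : Type*} [Fintype N] [DecidableEq N] {i j k : N} {L : Finset N} (hij : i ≠ j) (hik : i ≠ k) (hjk : j ≠ k)
    (hi : i ∉ L) (hj : j ∉ L) (hk : k ∉ L) (ε : ℚ) (hε : 0 < ε) :
    ∃ Sig : Matrix N N ℚ, Sig.IsSymm ∧ PosDefMinors Sig ∧ CIS Sig = FF i j k L ∧
          ∀ a b : N, |Sig a b - (1 : Matrix N N ℚ) a b| < ε := by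
  have hcont := genM_cont i j k L
  have hz := genM_zero (R := ℚ) i j k L hij hik hi
  have ev1 : ∀ᶠ x in nhds (0 : Sym2 N → ℚ), ∀ S, 0 < pminor (genM i j k L x) S := by
    rw [Filter.eventually_all]
    intro S
    have hc : Continuous (fun x : Sym2 N → ℚ => pminor (genM i j k L x) S) := by
      unfold pminor
      exact (hcont.matrix_submatrix _ _).matrix_det
    have h0 : 0 < pminor (genM i j k L (0 : Sym2 N → ℚ)) S := by
      rw [hz, pminor, Matrix.submatrix_one _ Subtype.val_injective]
      simp
    exact hc.continuousAt.eventually (lt_mem_nhds h0)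
  have ev2 : ∀ᶠ x in nhds (0 : Sym2 N → ℚ), ∀ a b, |genM i j k L x a b - (1 : Matrix N N ℚ) a b| < ε := by
    rw [Filter.eventually_all]
    intro a
    rw [Filter.eventually_all]
    intro b
    have hc : Continuous (fun x : Sym2 N → ℚ => |genM i j k L x a b - (1 : Matrix N N ℚ) a b|) :=
      ((hcont.matrix_elem a b).sub continuous_const).abs
    have h0 : |genM i j k L (0 : Sym2 N → ℚ) a b - (1 : Matrix N N ℚ) a b| < ε := by
      rw [hz]; simpa using hε
    exact hc.continuousAt.eventually (gt_mem_nhds h0)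
  obtain ⟨δ, hδ, hball⟩ := Metric.eventually_nhds_iff.mp (ev1.and ev2)
  classical
  let X : Sym2 N → MvPolynomial (Sym2 N) ℚ := MvPolynomial.X
  let T : Finset (N × N × Finset N) := Finset.univ.filter fun p =>
    p.1 ≠ p.2.1 ∧ p.1 ∉ p.2.2 ∧ p.2.1 ∉ p.2.2 ∧ (s(p.1, p.2.1), p.2.2) ∉ FF i j k L
  let P : MvPolynomial (Sym2 N) ℚ := ∏ p ∈ T, apminor (genM i j k L X) p.1 p.2.1 p.2.2
  have hev : ∀ (x : Sym2 N → ℚ) a b K, MvPolynomial.eval x (apminor (genM i j k L X) a b K) =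
      apminor (genM i j k L x) a b K := by
    intro x a b K
    rw [← apminor_map, genM_map]
    congr 2
    ext e
    simp [X]
  have hP : P ≠ 0 := by
    rw [Finset.prod_ne_zero_iff]
    rintro ⟨a, b, K⟩ hp h0
    simp only [T, Finset.mem_filter, Finset.mem_univ, true_and] at hp
    obtain ⟨x, hx⟩ := wit_exists hij hik hjk hi hj hk a b K hp.1 hp.2.1 hp.2.2.1 hp.2.2.2
    apply hx
    rw [← hev, h0, map_zero]
  obtain ⟨x, hxd, hx⟩ : ∃ x : Sym2 N → ℚ, dist x 0 < δ ∧ MvPolynomial.eval x P ≠ 0 := by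
    by_contra hcon
    push Not at hcon
    obtain ⟨dl, hdl, hδδ⟩ := exists_rat_btwn hδ
    have hdl : 0 < dl := by exact_mod_cast hdl
    apply hP
    refine MvPolynomial.funext_set (fun _ => Set.Ioo (-dl) dl) (fun _ => Set.Ioo_infinite (by linarith)) ?_
    intro x hx
    rw [map_zero]
    apply hcon
    rw [dist_pi_lt_iff hδ]
    intro e
    have := hx e (Set.mem_univ e)
    have h2 : |x e| < dl := abs_lt.mpr this
    rw [Rat.dist_eq]
    simp only [Pi.zero_apply, Rat.cast_zero, sub_zero]
    have h3 : ((|x e| : ℚ) : ℝ) < (dl : ℝ) := by exact_mod_cast h2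
    push_cast at h3
    linarith
  obtain ⟨hpd, hclose⟩ := hball hxd
  have hsym := genM_symm (k := k) (L := L) hij hik hi x
  refine ⟨genM i j k L x, hsym, hpd, ?_, hclose⟩
  have hnz : ∀ a b K, a ≠ b → a ∉ K → b ∉ K → (s(a,b), K) ∉ FF i j k L →
      apminor (genM i j k L x) a b K ≠ 0 := by
    intro a b K h1 h2 h3 h4
    rw [map_prod, Finset.prod_ne_zero_iff] at hx
    rw [← hev]
    exact hx (a, b, K) (by simp [T, *])
  ext ⟨e, K⟩
  induction e using Sym2.ind with
  | _ a b =>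
  constructor
  · rintro ⟨hprop, h⟩
    by_contra hn
    simp only [CIStmt.proper, Sym2.mk_isDiag_iff, Sym2.mem_iff] at hprop
    exact hnz a b K (by grind) (by grind) (by grind) hn (h a b rfl)
  · intro hm
    refine ⟨(FF_gaussoid hij hik hjk hi hj hk).1 _ hm, ?_⟩
    intro c d hcd
    simp only at hcd ⊢
    rw [hcd, mem_FF] at hm
    have hv := genM_vanish (k := k) hij hik hi x
    have hsw := apminor_symm _ hsym c d K
    rcases hm with ⟨⟨rfl, rfl⟩ | ⟨rfl, rfl⟩, hK⟩ | ⟨⟨rfl, rfl⟩ | ⟨rfl, rfl⟩, hK⟩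
    · exact hv _ _ (by grind) (by grind) (by grind)
    · rw [hsw]; exact hv _ _ (by grind) (by grind) (by grind)
    · exact hv _ _ (by grind) (by grind) (by grind)
    · rw [hsw]; exact hv _ _ (by grind) (by grind) (by grind)

theorem stmt12 {N : Type*} [Fintype N] [DecidableEq N]
    (s t : CIStmt N) (hs : s.proper) (ht : t.proper) (hst : s ≠ t)
    (hnotg : ¬ IsGaussoid ({s, t} : Set (CIStmt N))) :
    ∀ G : Set (CIStmt N), IsGaussoid G → ({s, t} : Set (CIStmt N)) ⊆ G →
      (∀ G' : Set (CIStmt N), IsGaussoid G' → ({s, t} : Set (CIStmt N)) ⊆ G' →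
        G' ⊆ G → G' = G) →
      G.encard = 4 ∧
      ∀ ε : ℚ, 0 < ε →
        ∃ Sig : Matrix N N ℚ, Sig.IsSymm ∧ PosDefMinors Sig ∧ CIS Sig = G ∧
          ∀ a b : N, |Sig a b - (1 : Matrix N N ℚ) a b| < ε := by
  intro G hG hsub hmin
  obtain ⟨i, j, k, L, hij, hik, hjk, hi, hj, hk, h1, h2⟩ := FF_sub hG hs ht hnotg hsub
  have := hmin _ (FF_gaussoid hij hik hjk hi hj hk) h2 h1
  subst this
  exact ⟨FF_encard hij hik hjk hj hk, fun ε hε => realize hij hik hjk hi hj hk ε hε⟩
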